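/- Let (F, G) be a Frobenius pair between abelian categories with enough projectives, with F faithful. Then for every object X of C, the Gorenstein projective dimension of X in C equals the Gorenstein projective dimension of F(X) in D. -/

import Mathlib

open CategoryTheory Limits

/-- An object `M` of an abelian category is *Gorenstein projective* if it is a syzygy
(the kernel `ker(P⁰ → P¹)`) of an acyclic complex `P` of projective objects such that
`Hom(P, Q)` is acyclic for every projective `Q`. -/
def IsGorensteinProjective {A : Type*} [Category A] [Abelian A] (M : A) : Prop :=
  ∃ P : CochainComplex A ℤ,
    (∀ n : ℤ, Projective (P.X n)) ∧
    (∀ n : ℤ, P.ExactAt n) ∧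
    Nonempty (M ≅ P.cycles 0) ∧
    ∀ (Q : A), Projective Q → ∀ (n : ℤ) (f : P.X n ⟶ Q), P.d (n - 1) n ≫ f = 0 →
      ∃ g : P.X (n + 1) ⟶ Q, P.d n (n + 1) ≫ g = f

/-- `φ : X ⟶ M` is an `𝒳`-precover of `M` if `X ∈ 𝒳` and every morphism from an object
of `𝒳` to `M` factors through `φ`. -/
def IsPrecover {A : Type*} [Category A] (𝒳 : A → Prop) {X M : A} (φ : X ⟶ M) : Prop :=
  𝒳 X ∧ ∀ (X' : A), 𝒳 X' → ∀ f : X' ⟶ M, ∃ g : X' ⟶ X, g ≫ φ = f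

open CategoryTheory Limits in
/-- `gpdLE M n` says that the Gorenstein projective dimension of `M` is at most `n`,
i.e. there is an exact sequence `0 → G_n → ⋯ → G_0 → M → 0` with all `G_i`
Gorenstein projective. -/
def gpdLE {A : Type*} [Category A] [Abelian A] : A → ℕ → Prop
  | M, 0 => IsGorensteinProjective M
  | M, (n + 1) => ∃ (G : A) (f : G ⟶ M),
      Epi f ∧ IsGorensteinProjective G ∧ gpdLE (kernel f) n

universe w v u v' u'

/-- The sequence `0 ⟶ X ⟶ Y ⟶ Z ⟶ 0` given by `f` and `g` is short exact. -/
structure IsShortExact {A : Type u} [Category.{v} A] [Abelian A] {X Y Z : A}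
    (f : X ⟶ Y) (g : Y ⟶ Z) : Prop where
  zero : f ≫ g = 0
  shortExact : (ShortComplex.mk f g zero).ShortExact

namespace IsShortExact

open scoped ZeroObject

variable {A : Type u} [Category.{v} A] [Abelian A]

section

variable {X Y Z : A} {f : X ⟶ Y} {g : Y ⟶ Z}

lemma mono (h : IsShortExact f g) : Mono f := h.shortExact.mono_f

lemma epi (h : IsShortExact f g) : Epi g := h.shortExact.epi_g

lemma exists_lift (h : IsShortExact f g) {T : A} (k : T ⟶ Y) (hk : k ≫ g = 0) :
    ∃ l : T ⟶ X, l ≫ f = k := by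
  have := h.shortExact.mono_f
  exact ⟨h.shortExact.exact.lift k hk, h.shortExact.exact.lift_f k hk⟩

lemma exists_desc (h : IsShortExact f g) {T : A} (k : Y ⟶ T) (hk : f ≫ k = 0) :
    ∃ l : Z ⟶ T, g ≫ l = k := by
  have := h.shortExact.epi_g
  exact ⟨h.shortExact.exact.desc k hk, h.shortExact.exact.g_desc k hk⟩

lemma of_refinements (w : f ≫ g = 0) (hf : Mono f) (hg : Epi g)
    (h : ∀ ⦃T : A⦄ (k : T ⟶ Y), k ≫ g = 0 →
      ∃ (T' : A) (π : T' ⟶ T) (_ : Epi π) (l : T' ⟶ X), π ≫ k = l ≫ f) :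
    IsShortExact f g where
  zero := w
  shortExact :=
    { exact := by
        rw [ShortComplex.exact_iff_exact_up_to_refinements]
        exact h }

lemma of_kernel (g : Y ⟶ Z) [Epi g] : IsShortExact (kernel.ι g) g where
  zero := kernel.condition g
  shortExact := { exact := ShortComplex.exact_of_f_is_kernel _ (kernelIsKernel g) }

lemma of_cokernel (f : X ⟶ Y) [Mono f] : IsShortExact f (cokernel.π f) where
  zero := cokernel.condition f
  shortExact := { exact := ShortComplex.exact_of_g_is_cokernel _ (cokernelIsCokernel f) }

lemma of_splitting (w : f ≫ g = 0) (s : (ShortComplex.mk f g w).Splitting) :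
    IsShortExact f g :=
  ⟨w, s.shortExact⟩

end

lemma id_zero (X : A) : IsShortExact (𝟙 X) (0 : X ⟶ 0) :=
  of_splitting (by simp) (.ofIsIsoOfIsZero _ inferInstance (isZero_zero A))

lemma zero_id (X : A) : IsShortExact (0 : 0 ⟶ X) (𝟙 X) :=
  of_splitting (by simp) (.ofIsZeroOfIsIso _ (isZero_zero A) inferInstance)

lemma biprod_inl_snd (X Y : A) : IsShortExact (biprod.inl : X ⟶ X ⊞ Y) biprod.snd :=
  of_splitting (by simp) (.ofHasBinaryBiproduct X Y)

lemma biprod_inr_fst (X Y : A) : IsShortExact (biprod.inr : Y ⟶ X ⊞ Y) biprod.fst :=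
  of_splitting (by simp)
    { r := biprod.snd, s := biprod.inl, id := by simp [add_comm] }

section NineLemma

variable {X₁ X₂ X₃ Y₁ Y₂ Y₃ Z₁ Z₂ Z₃ : A}
  {x : X₁ ⟶ X₂} {x' : X₂ ⟶ X₃} {y : Y₁ ⟶ Y₂} {y' : Y₂ ⟶ Y₃} {z : Z₁ ⟶ Z₂} {z' : Z₂ ⟶ Z₃}
  {a₁ : X₁ ⟶ Y₁} {b₁ : Y₁ ⟶ Z₁} {a₂ : X₂ ⟶ Y₂} {b₂ : Y₂ ⟶ Z₂} {a₃ : X₃ ⟶ Y₃} {b₃ : Y₃ ⟶ Z₃}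

/-- The nine lemma: in a `3 × 3` diagram with short exact columns and
short exact first two rows, the third row is short exact. -/
lemma exists_third_row (hx : IsShortExact x x') (hy : IsShortExact y y')
    (h₁ : IsShortExact a₁ b₁) (h₂ : IsShortExact a₂ b₂) (h₃ : IsShortExact a₃ b₃)
    (c₁ : x ≫ a₂ = a₁ ≫ y) (c₂ : x' ≫ a₃ = a₂ ≫ y') :
    ∃ (z : Z₁ ⟶ Z₂) (z' : Z₂ ⟶ Z₃), b₁ ≫ z = y ≫ b₂ ∧ b₂ ≫ z' = y' ≫ b₃ ∧
      IsShortExact z z' := by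
  have := hy.mono; have := hy.epi; have := hx.epi; have := h₁.epi; have := h₂.epi
  have := h₃.epi; have := h₃.mono
  obtain ⟨z, hz⟩ := h₁.exists_desc (y ≫ b₂) (by
    rw [← Category.assoc, ← c₁, Category.assoc, h₂.zero, comp_zero])
  obtain ⟨z', hz'⟩ := h₂.exists_desc (y' ≫ b₃) (by
    rw [← Category.assoc, ← c₂, Category.assoc, h₃.zero, comp_zero])
  refine ⟨z, z', hz, hz', of_refinements ?_ ?_ ?_ ?_⟩
  · rw [← cancel_epi b₁, reassoc_of% hz, hz', ← Category.assoc, hy.zero, zero_comp, comp_zero]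
  · rw [Preadditive.mono_iff_cancel_zero]
    intro T t ht
    obtain ⟨T₁, π, _, t₁, h_t₁⟩ := surjective_up_to_refinements_of_epi b₁ t
    obtain ⟨t₂, h_t₂⟩ := h₂.exists_lift (t₁ ≫ y) (by
      rw [Category.assoc, ← hz, ← Category.assoc, ← h_t₁, Category.assoc, ht, comp_zero])
    obtain ⟨t₃, h_t₃⟩ := hx.exists_lift t₂ (by
      rw [← cancel_mono a₃, Category.assoc, c₂, reassoc_of% h_t₂, hy.zero, comp_zero, zero_comp])
    have : t₃ ≫ a₁ = t₁ := by
      rw [← cancel_mono y, Category.assoc, ← c₁, reassoc_of% h_t₃, h_t₂]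
    rw [← cancel_epi π, h_t₁, ← this, Category.assoc, h₁.zero, comp_zero, comp_zero]
  · have : Epi (b₂ ≫ z') := by rw [hz']; infer_instance
    exact epi_of_epi b₂ z'
  · intro T t ht
    obtain ⟨T₁, π₁, _, t₁, h_t₁⟩ := surjective_up_to_refinements_of_epi b₂ t
    obtain ⟨t₂, h_t₂⟩ := h₃.exists_lift (t₁ ≫ y') (by
      rw [Category.assoc, ← hz', ← Category.assoc, ← h_t₁, Category.assoc, ht, comp_zero])
    obtain ⟨T₂, π₂, _, t₃, h_t₃⟩ := surjective_up_to_refinements_of_epi x' t₂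
    obtain ⟨t₄, h_t₄⟩ := hy.exists_lift (π₂ ≫ t₁ - t₃ ≫ a₂) (by
      rw [Preadditive.sub_comp, Category.assoc, Category.assoc, ← h_t₂, ← c₂, reassoc_of% h_t₃,
        sub_self])
    refine ⟨T₂, π₂ ≫ π₁, epi_comp _ _, t₄ ≫ b₁, ?_⟩
    rw [Category.assoc, Category.assoc, hz, reassoc_of% h_t₄, Preadditive.sub_comp, h_t₁,
      Category.assoc, Category.assoc, h₂.zero, comp_zero, sub_zero]

/-- The nine lemma: in a `3 × 3` diagram with short exact columns and
short exact last two rows, the first row is short exact. -/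
lemma exists_first_row (hy : IsShortExact y y') (hz : IsShortExact z z')
    (h₁ : IsShortExact a₁ b₁) (h₂ : IsShortExact a₂ b₂) (h₃ : IsShortExact a₃ b₃)
    (c₁ : y ≫ b₂ = b₁ ≫ z) (c₂ : y' ≫ b₃ = b₂ ≫ z') :
    ∃ (x : X₁ ⟶ X₂) (x' : X₂ ⟶ X₃), x ≫ a₂ = a₁ ≫ y ∧ x' ≫ a₃ = a₂ ≫ y' ∧
      IsShortExact x x' := by
  have := hy.mono; have := hy.epi; have := hz.mono; have := h₁.mono; have := h₂.mono
  have := h₃.mono; have := h₁.epi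
  obtain ⟨x, hx⟩ := h₂.exists_lift (a₁ ≫ y) (by
    rw [Category.assoc, c₁, ← Category.assoc, h₁.zero, zero_comp])
  obtain ⟨x', hx'⟩ := h₃.exists_lift (a₂ ≫ y') (by
    rw [Category.assoc, c₂, ← Category.assoc, h₂.zero, zero_comp])
  refine ⟨x, x', hx, hx', of_refinements ?_ ?_ ?_ ?_⟩
  · rw [← cancel_mono a₃, Category.assoc, hx', reassoc_of% hx, hy.zero, zero_comp, comp_zero]
  · have : Mono (x ≫ a₂) := by rw [hx]; infer_instance
    exact mono_of_mono x a₂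
  · rw [epi_iff_surjective_up_to_refinements]
    intro T t
    obtain ⟨T₁, π₁, _, t₁, h_t₁⟩ := surjective_up_to_refinements_of_epi y' (t ≫ a₃)
    obtain ⟨t₂, h_t₂⟩ := hz.exists_lift (t₁ ≫ b₂) (by
      rw [Category.assoc, ← c₂, ← Category.assoc, ← h_t₁, Category.assoc, Category.assoc, h₃.zero,
        comp_zero, comp_zero])
    obtain ⟨T₂, π₂, _, t₃, h_t₃⟩ := surjective_up_to_refinements_of_epi b₁ t₂
    obtain ⟨t₄, h_t₄⟩ := h₂.exists_lift (π₂ ≫ t₁ - t₃ ≫ y) (by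
      rw [Preadditive.sub_comp, Category.assoc, Category.assoc, ← h_t₂, c₁, reassoc_of% h_t₃,
        sub_self])
    refine ⟨T₂, π₂ ≫ π₁, epi_comp _ _, t₄, ?_⟩
    rw [← cancel_mono a₃, Category.assoc, Category.assoc, Category.assoc, h_t₁, hx',
      reassoc_of% h_t₄, Preadditive.sub_comp, Category.assoc, Category.assoc, hy.zero, comp_zero,
      sub_zero]
  · intro T t ht
    obtain ⟨t₁, h_t₁⟩ := hy.exists_lift (t ≫ a₂) (by
      rw [Category.assoc, ← hx', ← Category.assoc, ht, zero_comp])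
    obtain ⟨t₂, h_t₂⟩ := h₁.exists_lift t₁ (by
      rw [← cancel_mono z, Category.assoc, ← c₁, reassoc_of% h_t₁, h₂.zero, comp_zero, zero_comp])
    refine ⟨T, 𝟙 T, inferInstance, t₂, ?_⟩
    rw [Category.id_comp, ← cancel_mono a₂, Category.assoc, hx, reassoc_of% h_t₂, h_t₁]

end NineLemma

lemma of_iso {X Y Z X' Z' : A} {f : X ⟶ Y} {g : Y ⟶ Z} (h : IsShortExact f g)
    (e : X' ≅ X) (e' : Z ≅ Z') : IsShortExact (e.hom ≫ f) (g ≫ e'.hom) := by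
  have w : (e.hom ≫ f) ≫ g ≫ e'.hom = 0 := by simp [reassoc_of% h.zero]
  let φ : ShortComplex.mk f g h.zero ≅ ShortComplex.mk (e.hom ≫ f) (g ≫ e'.hom) w :=
    ShortComplex.isoMk e.symm (Iso.refl _) e' (by simp) (by simp)
  exact ⟨w, ShortComplex.shortExact_of_iso φ h.shortExact⟩

lemma exists_swap_of_extension {X Y Z : A} {f : X ⟶ Y} {g : Y ⟶ Z} (h : IsShortExact f g)
    {r : Y ⟶ X} (hr : f ≫ r = 𝟙 X) : ∃ s : Z ⟶ Y, IsShortExact s r := by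
  have := h.epi
  let σ := ShortComplex.Splitting.ofExactOfRetraction (ShortComplex.mk f g h.zero)
    h.shortExact.exact r hr h.epi
  exact ⟨σ.s, of_splitting σ.s_r
    { r := g, s := f, f_r := σ.s_g, s_g := σ.f_r, id := by rw [add_comm]; exact σ.id }⟩

lemma map {B : Type u'} [Category.{v'} B] [Abelian B] (F : A ⥤ B) [F.Additive]
    [PreservesFiniteLimits F] [PreservesFiniteColimits F] {X Y Z : A} {f : X ⟶ Y} {g : Y ⟶ Z}
    (h : IsShortExact f g) : IsShortExact (F.map f) (F.map g) where
  zero := by rw [← F.map_comp, h.zero, F.map_zero]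
  shortExact := h.shortExact.map_of_exact F

end IsShortExact

section GorensteinProjective

variable {A : Type u} [Category.{v} A] [Abelian A]

/-- There is a short exact sequence `0 ⟶ X ⟶ P ⟶ Y ⟶ 0` with `P` projective such that
every morphism from `X` to a projective object extends to `P`. -/
def IsProperSyzygy (X Y : A) : Prop :=
  ∃ (P : A) (i : X ⟶ P) (p : P ⟶ Y), IsShortExact i p ∧ Projective P ∧
    ∀ Q : A, Projective Q → ∀ f : X ⟶ Q, ∃ g : P ⟶ Q, i ≫ g = f

lemma isGorensteinProjective_of_isProperSyzygy {X : A} (Z : ℤ → A) (e : X ≅ Z 0)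
    (hZ : ∀ n, IsProperSyzygy (Z n) (Z (n + 1))) : IsGorensteinProjective X := by
  choose P i p h hP hQ using hZ
  have hi (n) := (h n).mono
  have hp (n) := (h n).epi
  let K : CochainComplex A ℤ := CochainComplex.of P (fun n ↦ p n ≫ i (n + 1)) (fun n ↦ by
    rw [Category.assoc, reassoc_of% (h (n + 1)).zero, zero_comp, comp_zero])
  have hd (n : ℤ) : K.d n (n + 1) = p n ≫ i (n + 1) :=
    CochainComplex.of_d P (fun n ↦ p n ≫ i (n + 1)) n
  have hker (n : ℤ) : Nonempty (IsLimit (KernelFork.ofι (f := K.d n (n + 1)) (i n)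
      (by rw [hd, reassoc_of% (h n).zero, zero_comp]))) :=
    ⟨KernelFork.IsLimit.ofι' _ _ fun k hk ↦ by
      have hk' : k ≫ p n = 0 := by
        rw [← cancel_mono (i (n + 1)), Category.assoc, ← hd, hk, zero_comp]
      exact ⟨_, ((h n).exists_lift k hk').choose_spec⟩⟩
  refine ⟨K, hP, fun n ↦ ?_, ⟨e ≪≫ ?_⟩, fun Q hQ' n f hf ↦ ?_⟩
  · obtain ⟨m, rfl⟩ : ∃ m, n = m + 1 := ⟨n - 1, by simp⟩
    rw [K.exactAt_iff' m (m + 1) (m + 1 + 1) (by simp) (by simp),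
      ShortComplex.exact_iff_exact_up_to_refinements]
    intro T k hk
    obtain ⟨l, hl⟩ := (KernelFork.IsLimit.lift' (hker (m + 1)).some k hk)
    obtain ⟨T', π, hπ, t, ht⟩ := surjective_up_to_refinements_of_epi (p m) l
    refine ⟨T', π, hπ, t, ?_⟩
    change π ≫ k = t ≫ K.d m (m + 1)
    rw [hd, ← reassoc_of% ht]
    exact congrArg (π ≫ ·) hl.symm
  · exact (hker 0).some.conePointUniqueUpToIso (K.cyclesIsKernel 0 (0 + 1) (by simp))
  · obtain ⟨m, rfl⟩ : ∃ m, n = m + 1 := ⟨n - 1, by simp⟩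
    rw [show m + 1 - 1 = m by simp, hd, Category.assoc] at hf
    have hf' : i (m + 1) ≫ f = 0 := by
      rw [← cancel_epi (p m), comp_zero]
      exact hf
    obtain ⟨g, hg⟩ := (h (m + 1)).exists_desc f hf'
    obtain ⟨g', hg'⟩ := hQ (m + 1 + 1) Q hQ' g
    exact ⟨g', by rw [hd, Category.assoc, hg', hg]⟩

lemma IsGorensteinProjective.exists_isProperSyzygy {X : A} (hX : IsGorensteinProjective X) :
    ∃ Z : ℤ → A, Nonempty (X ≅ Z 0) ∧ ∀ n, IsProperSyzygy (Z n) (Z (n + 1)) := by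
  obtain ⟨K, hK, hex, e, hQ⟩ := hX
  refine ⟨fun n ↦ K.cycles n, e, fun n ↦ ?_⟩
  have hse (n : ℤ) : IsShortExact (K.iCycles n) (K.toCycles n (n + 1)) := by
    refine .of_refinements ?_ inferInstance ?_ ?_
    · rw [← cancel_mono (K.iCycles (n + 1))]
      simp
    · rw [epi_iff_surjective_up_to_refinements]
      intro T t
      have hn := hex (n + 1)
      rw [K.exactAt_iff' n (n + 1) (n + 1 + 1) (by simp) (by simp)] at hn
      have h0 : (t ≫ K.iCycles (n + 1)) ≫ K.d (n + 1) (n + 1 + 1) = 0 := by simp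
      have hl : ∃ (T' : A) (π : T' ⟶ T) (_ : Epi π) (l : T' ⟶ K.X n),
          π ≫ t ≫ K.iCycles (n + 1) = l ≫ K.d n (n + 1) := hn.exact_up_to_refinements _ h0
      obtain ⟨T', π, hπ, l, hl⟩ := hl
      exact ⟨T', π, hπ, l, by simp [← cancel_mono (K.iCycles (n + 1)), hl]⟩
    · intro T k hk
      have hk' : k ≫ K.d n (n + 1) = 0 := by rw [← K.toCycles_i, reassoc_of% hk, zero_comp]
      exact ⟨T, 𝟙 T, inferInstance, K.liftCycles k (n + 1) (by simp) hk', by simp⟩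
  refine ⟨K.X n, K.iCycles n, K.toCycles n (n + 1), hse n, hK n, fun Q hQ' f ↦ ?_⟩
  obtain ⟨m, rfl⟩ : ∃ m, n = m + 1 := ⟨n - 1, by simp⟩
  have := (hse m).epi
  obtain ⟨g, hg⟩ := hQ Q hQ' m (K.toCycles m (m + 1) ≫ f) (by simp)
  exact ⟨g, by rw [← cancel_epi (K.toCycles m (m + 1)), K.toCycles_i_assoc, hg]⟩

lemma IsProperSyzygy.of_iso {X Y X' Y' : A} (h : IsProperSyzygy X Y) (e : X' ≅ X) (e' : Y ≅ Y') :
    IsProperSyzygy X' Y' := by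
  obtain ⟨P, i, p, hip, hP, hQ⟩ := h
  refine ⟨P, e.hom ≫ i, p ≫ e'.hom, hip.of_iso e e', hP, fun Q hQ' f ↦ ?_⟩
  obtain ⟨g, hg⟩ := hQ Q hQ' (e.inv ≫ f)
  exact ⟨g, by simp [hg]⟩

namespace IsGorensteinProjective

lemma of_iso {X Y : A} (hX : IsGorensteinProjective X) (e : X ≅ Y) :
    IsGorensteinProjective Y := by
  obtain ⟨K, hK, hex, ⟨e'⟩, hQ⟩ := hX
  exact ⟨K, hK, hex, ⟨e.symm ≪≫ e'⟩, hQ⟩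

lemma exists_cosyzygy {X : A} (hX : IsGorensteinProjective X) :
    ∃ Y, IsProperSyzygy X Y ∧ IsGorensteinProjective Y := by
  obtain ⟨Z, ⟨e⟩, hZ⟩ := hX.exists_isProperSyzygy
  exact ⟨Z (0 + 1), (hZ 0).of_iso e (Iso.refl _),
    isGorensteinProjective_of_isProperSyzygy (fun n ↦ Z (n + 1)) (Iso.refl _) fun n ↦ hZ (n + 1)⟩

lemma exists_syzygy {X : A} (hX : IsGorensteinProjective X) :
    ∃ Y, IsProperSyzygy Y X ∧ IsGorensteinProjective Y := by
  obtain ⟨Z, ⟨e⟩, hZ⟩ := hX.exists_isProperSyzygy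
  refine ⟨Z (-1), (hZ (-1)).of_iso (Iso.refl _) e.symm,
    isGorensteinProjective_of_isProperSyzygy (fun n ↦ Z (n - 1)) (Iso.refl _) fun n ↦ ?_⟩
  have := hZ (n - 1)
  rwa [show n - 1 + 1 = n + 1 - 1 by ring] at this

end IsGorensteinProjective

open Abelian

section Ext

/-- All positive `Ext`-groups from `X` to projective objects vanish. -/
def IsLeftExtOrthogonal [HasExt.{w} A] (X : A) : Prop :=
  ∀ (n : ℕ) (Q : A), Projective Q → Subsingleton (Ext.{w} X Q (n + 1))

variable [HasExt.{w} A]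

lemma IsShortExact.ext_subsingleton_left {X Y Z Q : A} {f : X ⟶ Y} {g : Y ⟶ Z}
    (h : IsShortExact f g) (n : ℕ) (hY : Subsingleton (Ext.{w} Y Q n))
    (hZ : Subsingleton (Ext.{w} Z Q (n + 1))) : Subsingleton (Ext.{w} X Q n) := by
  refine subsingleton_of_forall_eq 0 fun x ↦ ?_
  obtain ⟨y, rfl⟩ := Ext.contravariant_sequence_exact₁ h.shortExact Q x (add_comm 1 n)
    (Subsingleton.elim _ _)
  rw [Subsingleton.elim y 0, Ext.comp_zero]

lemma IsShortExact.ext_subsingleton_middle {X Y Z Q : A} {f : X ⟶ Y} {g : Y ⟶ Z}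
    (h : IsShortExact f g) (n : ℕ) (hX : Subsingleton (Ext.{w} X Q n))
    (hZ : Subsingleton (Ext.{w} Z Q n)) : Subsingleton (Ext.{w} Y Q n) := by
  refine subsingleton_of_forall_eq 0 fun x ↦ ?_
  obtain ⟨y, rfl⟩ := Ext.contravariant_sequence_exact₂ h.shortExact Q x (Subsingleton.elim _ _)
  rw [Subsingleton.elim y 0, Ext.comp_zero]

lemma IsShortExact.ext_subsingleton_right {X Y Z Q : A} {f : X ⟶ Y} {g : Y ⟶ Z}
    (h : IsShortExact f g) (n : ℕ) (hX : Subsingleton (Ext.{w} X Q n))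
    (hY : Subsingleton (Ext.{w} Y Q (n + 1))) : Subsingleton (Ext.{w} Z Q (n + 1)) := by
  refine subsingleton_of_forall_eq 0 fun x ↦ ?_
  obtain ⟨y, rfl⟩ := Ext.contravariant_sequence_exact₃ h.shortExact Q x (Subsingleton.elim _ _)
    (add_comm 1 n)
  rw [Subsingleton.elim y 0, Ext.comp_zero]

lemma IsShortExact.ext_one_subsingleton {X P Y Q : A} {i : X ⟶ P} {p : P ⟶ Y}
    (h : IsShortExact i p) (hP : Projective P) (hQ : ∀ f : X ⟶ Q, ∃ g : P ⟶ Q, i ≫ g = f) :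
    Subsingleton (Ext.{w} Y Q 1) := by
  refine subsingleton_of_forall_eq 0 fun x ↦ ?_
  obtain ⟨y, rfl⟩ := Ext.contravariant_sequence_exact₃ h.shortExact Q x
    (Ext.eq_zero_of_projective _) (add_comm 1 0)
  obtain ⟨f, rfl⟩ := (Ext.mk₀_bijective _ _).2 y
  obtain ⟨g, rfl⟩ := hQ f
  rw [← Ext.mk₀_comp_mk₀]
  exact h.shortExact.extClass_comp_assoc _

lemma IsShortExact.exists_extension {X Y Z Q : A} {f : X ⟶ Y} {g : Y ⟶ Z}
    (h : IsShortExact f g) (hZ : Subsingleton (Ext.{w} Z Q 1)) (k : X ⟶ Q) :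
    ∃ l : Y ⟶ Q, f ≫ l = k := by
  obtain ⟨y, hy⟩ := Ext.contravariant_sequence_exact₁ h.shortExact Q (Ext.mk₀ k) (add_comm 1 0)
    (Subsingleton.elim _ _)
  obtain ⟨l, rfl⟩ := (Ext.mk₀_bijective _ _).2 y
  exact ⟨l, (Ext.mk₀_bijective _ _).1 (by rw [← hy, Ext.mk₀_comp_mk₀])⟩

lemma IsLeftExtOrthogonal.of_projective {P : A} (hP : Projective P) :
    IsLeftExtOrthogonal.{w} P :=
  fun n Q _ ↦ Ext.subsingleton_of_projective P Q n

/-- Dimension shifting: a class of objects closed under proper syzygies is left orthogonal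
to the projective objects. -/
lemma IsLeftExtOrthogonal.of_syzygies (Φ : A → Prop)
    (h : ∀ X, Φ X → ∃ Y, IsProperSyzygy Y X ∧ Φ Y) {X : A} (hX : Φ X) :
    IsLeftExtOrthogonal.{w} X := by
  intro n Q hQ
  induction n generalizing X with
  | zero =>
    obtain ⟨Y, ⟨P, i, p, hip, hP, hext⟩, hY⟩ := h X hX
    exact hip.ext_one_subsingleton hP (hext Q hQ)
  | succ n ih =>
    obtain ⟨Y, ⟨P, i, p, hip, hP, hext⟩, hY⟩ := h X hX
    exact hip.ext_subsingleton_right _ (ih hY) (Ext.subsingleton_of_projective P Q _)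

lemma IsGorensteinProjective.isLeftExtOrthogonal {X : A} (hX : IsGorensteinProjective X) :
    IsLeftExtOrthogonal.{w} X :=
  .of_syzygies IsGorensteinProjective (fun _ h ↦ h.exists_syzygy) hX

lemma IsLeftExtOrthogonal.isProperSyzygy {X P Y : A} {i : X ⟶ P} {p : P ⟶ Y}
    (hY : IsLeftExtOrthogonal.{w} Y) (h : IsShortExact i p) (hP : Projective P) :
    IsProperSyzygy X Y :=
  ⟨P, i, p, h, hP, fun Q hQ f ↦ h.exists_extension (hY 0 Q hQ) f⟩

variable [EnoughProjectives A]

lemma isGorensteinProjective_of_coresolution (Φ : A → Prop)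
    (h : ∀ X, Φ X → IsLeftExtOrthogonal.{w} X ∧ ∃ (P Y : A) (i : X ⟶ P) (p : P ⟶ Y),
      IsShortExact i p ∧ Projective P ∧ Φ Y) {X : A} (hX : Φ X) :
    IsGorensteinProjective X := by
  have hs (x : {X : A // Φ X}) : ∃ y : {X : A // Φ X}, IsProperSyzygy x.1 y.1 := by
    obtain ⟨_, P, Y, i, p, hip, hP, hY⟩ := h x.1 x.2
    exact ⟨⟨Y, hY⟩, (h Y hY).1.isProperSyzygy hip hP⟩
  have hp (x : {X : A // IsLeftExtOrthogonal.{w} X}) :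
      ∃ y : {X : A // IsLeftExtOrthogonal.{w} X}, IsProperSyzygy y.1 x.1 := by
    have hπ := IsShortExact.of_kernel (Projective.π x.1)
    exact ⟨⟨kernel (Projective.π x.1), fun n Q hQ ↦ hπ.ext_subsingleton_left _
      (Ext.subsingleton_of_projective _ Q n) (x.2 _ Q hQ)⟩,
      x.2.isProperSyzygy hπ inferInstance⟩
  choose s hs using hs
  choose p hp using hp
  let Z : ℤ → A
    | .ofNat n => (s^[n] ⟨X, hX⟩).1
    | .negSucc n => (p^[n + 1] ⟨X, (h X hX).1⟩).1
  refine isGorensteinProjective_of_isProperSyzygy Z (Iso.refl X) fun n ↦ ?_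
  match n with
  | .ofNat n =>
    change IsProperSyzygy (s^[n] ⟨X, hX⟩).1 (s^[n + 1] ⟨X, hX⟩).1
    rw [Function.iterate_succ_apply']
    exact hs _
  | .negSucc 0 => exact hp ⟨X, (h X hX).1⟩
  | .negSucc (n + 1) =>
    change IsProperSyzygy (p^[n + 1 + 1] ⟨X, (h X hX).1⟩).1 (p^[n + 1] ⟨X, (h X hX).1⟩).1
    rw [Function.iterate_succ_apply' p (n + 1)]
    exact hp _

end Ext

namespace IsGorensteinProjective

lemma exists_coresolution {X : A} (hX : IsGorensteinProjective X) :
    ∃ (P Y : A) (i : X ⟶ P) (p : P ⟶ Y), IsShortExact i p ∧ Projective P ∧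
      IsGorensteinProjective Y := by
  obtain ⟨Y, ⟨P, i, p, h, hP, -⟩, hY⟩ := hX.exists_cosyzygy
  exact ⟨P, Y, i, p, h, hP, hY⟩

lemma exists_extension {X Y Z Q : A} {f : X ⟶ Y} {g : Y ⟶ Z} (hZ : IsGorensteinProjective Z)
    (h : IsShortExact f g) (hQ : Projective Q) (k : X ⟶ Q) : ∃ l : Y ⟶ Q, f ≫ l = k := by
  have := HasExt.standard A
  exact h.exists_extension.{max u v} (hZ.isLeftExtOrthogonal 0 Q hQ) k

lemma exists_extension_coresolution {X Y Z : A} {f : X ⟶ Y} {g : Y ⟶ Z} (h : IsShortExact f g)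
    (hX : IsGorensteinProjective X) (hZ : IsGorensteinProjective Z) :
    ∃ (P X' Y' Z' : A) (i : Y ⟶ P) (p : P ⟶ Y') (f' : X' ⟶ Y') (g' : Y' ⟶ Z'),
      IsShortExact i p ∧ Projective P ∧ IsShortExact f' g' ∧ IsGorensteinProjective X' ∧
      IsGorensteinProjective Z' := by
  obtain ⟨P, X', i, p, hip, hP, hX'⟩ := hX.exists_coresolution
  obtain ⟨Q, Z', j, q, hjq, hQ, hZ'⟩ := hZ.exists_coresolution
  have := hip.mono
  have := hjq.mono
  obtain ⟨l, hl⟩ := hZ.exists_extension h hP i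
  have : Mono (biprod.lift l (g ≫ j)) := by
    rw [Preadditive.mono_iff_cancel_zero]
    intro T t ht
    have h₁ : t ≫ l = 0 := by simpa using ht =≫ biprod.fst
    have h₂ : t ≫ g = 0 := by
      rw [← cancel_mono j]
      simpa using ht =≫ biprod.snd
    obtain ⟨t', rfl⟩ := h.exists_lift t h₂
    have : t' = 0 := by rw [← cancel_mono i, ← hl, ← Category.assoc, h₁, zero_comp]
    rw [this, zero_comp]
  have hY := IsShortExact.of_cokernel (biprod.lift l (g ≫ j))
  obtain ⟨f', g', -, -, h'⟩ := IsShortExact.exists_third_row h (.biprod_inl_snd P Q) hip hY hjq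
    (by ext <;> simp [hl, reassoc_of% h.zero]) (by simp)
  exact ⟨_, _, _, _, _, _, f', g', hY, inferInstance, h', hX', hZ'⟩

end IsGorensteinProjective

namespace gpdLE

lemma of_iso {M N : A} {n : ℕ} (h : gpdLE M n) (e : M ≅ N) : gpdLE N n := by
  induction n generalizing M N with
  | zero => exact IsGorensteinProjective.of_iso h e
  | succ n ih =>
    obtain ⟨G, f, hf, hG, hK⟩ := h
    exact ⟨G, f ≫ e.hom, epi_comp _ _, hG, ih hK (kernelCompMono f e.hom).symm⟩

lemma of_isShortExact {K G M : A} {f : K ⟶ G} {g : G ⟶ M} {n : ℕ} (h : IsShortExact f g)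
    (hG : IsGorensteinProjective G) (hK : gpdLE K n) : gpdLE M (n + 1) :=
  have := h.mono
  ⟨G, g, h.epi, hG, hK.of_iso
    (h.shortExact.fIsKernel.conePointUniqueUpToIso (limit.isLimit (parallelPair g 0)))⟩

lemma exists_isShortExact {M : A} {n : ℕ} (h : gpdLE M (n + 1)) :
    ∃ (K G : A) (f : K ⟶ G) (g : G ⟶ M), IsShortExact f g ∧ IsGorensteinProjective G ∧
      gpdLE K n := by
  obtain ⟨G, g, _, hG, hK⟩ := h
  exact ⟨_, G, _, g, .of_kernel g, hG, hK⟩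

end gpdLE

variable [EnoughProjectives A]

namespace IsGorensteinProjective

lemma of_projective {P : A} (hP : Projective P) : IsGorensteinProjective P := by
  have := HasExt.standard A
  exact isGorensteinProjective_of_coresolution.{max u v} Projective (fun X hX ↦
    ⟨.of_projective hX, X, _, 𝟙 X, 0, .id_zero X, hX, inferInstance⟩) hP

lemma of_isLeftExtOrthogonal [HasExt.{w} A] {X P Y : A} {i : X ⟶ P} {p : P ⟶ Y}
    (hX : IsLeftExtOrthogonal.{w} X) (h : IsShortExact i p) (hP : Projective P)
    (hY : IsGorensteinProjective Y) : IsGorensteinProjective X :=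
  isGorensteinProjective_of_coresolution.{w} (fun X ↦ IsLeftExtOrthogonal.{w} X ∧
    ∃ (P Y : A) (i : X ⟶ P) (p : P ⟶ Y), IsShortExact i p ∧ Projective P ∧
      IsGorensteinProjective Y)
    (fun _ ⟨hX, P, Y, i, p, h, hP, hY⟩ ↦ ⟨hX, P, Y, i, p, h, hP,
      hY.isLeftExtOrthogonal, hY.exists_coresolution⟩)
    ⟨hX, P, Y, i, p, h, hP, hY⟩

lemma of_extension {X Y Z : A} {f : X ⟶ Y} {g : Y ⟶ Z} (h : IsShortExact f g)
    (hX : IsGorensteinProjective X) (hZ : IsGorensteinProjective Z) :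
    IsGorensteinProjective Y := by
  have := HasExt.standard A
  refine isGorensteinProjective_of_coresolution.{max u v}
    (fun Y ↦ ∃ (X Z : A) (f : X ⟶ Y) (g : Y ⟶ Z), IsShortExact f g ∧
      IsGorensteinProjective X ∧ IsGorensteinProjective Z) ?_ ⟨X, Z, f, g, h, hX, hZ⟩
  rintro Y ⟨X, Z, f, g, h, hX, hZ⟩
  obtain ⟨P, X', Y', Z', i, p, f', g', hip, hP, h', hX', hZ'⟩ :=
    exists_extension_coresolution h hX hZ
  exact ⟨fun n Q hQ ↦ h.ext_subsingleton_middle _ (hX.isLeftExtOrthogonal n Q hQ)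
    (hZ.isLeftExtOrthogonal n Q hQ), P, Y', i, p, hip, hP, X', Z', f', g', h', hX', hZ'⟩

lemma of_isShortExact_projective {K P Y : A} {i : K ⟶ P} {p : P ⟶ Y} (h : IsShortExact i p)
    (hP : Projective P) (hY : IsGorensteinProjective Y) : IsGorensteinProjective K := by
  have := HasExt.standard A
  refine of_isLeftExtOrthogonal.{max u v} (fun n Q hQ ↦ ?_) h hP hY
  exact h.ext_subsingleton_left _ (Ext.subsingleton_of_projective P Q n)
    (hY.isLeftExtOrthogonal _ Q hQ)

/-- Gorenstein projective objects are closed under kernels of epimorphisms. -/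
lemma of_isShortExact {X Y Z : A} {f : X ⟶ Y} {g : Y ⟶ Z} (h : IsShortExact f g)
    (hY : IsGorensteinProjective Y) (hZ : IsGorensteinProjective Z) :
    IsGorensteinProjective X := by
  obtain ⟨P, Y', i, p, hip, hP, hY'⟩ := hY.exists_coresolution
  have := h.mono
  have := hip.mono
  have hX := IsShortExact.of_cokernel (f ≫ i)
  obtain ⟨f', g', -, -, h'⟩ := IsShortExact.exists_third_row (.id_zero X) hip h hX
    (.zero_id Y') (by simp) (by simp [hip.zero])
  exact of_isShortExact_projective hX hP (of_extension h' hZ hY')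

lemma of_isProperSyzygy {X Y : A} (hX : IsGorensteinProjective X) (h : IsProperSyzygy X Y) :
    IsGorensteinProjective Y := by
  obtain ⟨P, i, p, hip, hP, hext⟩ := h
  obtain ⟨Q, L, j, q, hjq, hQ, hL⟩ := hX.exists_coresolution
  have := hip.mono
  have := hjq.mono
  have : Mono (biprod.lift i j) := mono_of_mono_fac (biprod.lift_fst i j)
  have hZ := IsShortExact.of_cokernel (biprod.lift i j)
  obtain ⟨_, _, -, -, h₁⟩ := IsShortExact.exists_third_row (.zero_id X) (.biprod_inl_snd P Q)
    (.zero_id P) hZ hjq (by simp) (by simp)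
  obtain ⟨k, _, hk, -, h₂⟩ := IsShortExact.exists_third_row (.zero_id X) (.biprod_inr_fst P Q)
    (.zero_id Q) hZ hip (by simp) (by simp)
  obtain ⟨g, hg⟩ := hext Q hQ j
  obtain ⟨r, hr⟩ := hZ.exists_desc (biprod.desc (-g) (𝟙 Q)) (by simp [biprod.lift_desc, hg])
  obtain ⟨_, h₃⟩ := h₂.exists_swap_of_extension (r := r) (by
    rw [Category.id_comp] at hk
    rw [hk, Category.assoc, hr, biprod.inr_desc])
  exact of_isShortExact h₃ (of_extension h₁ (of_projective hP) hL) (of_projective hQ)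

end IsGorensteinProjective

namespace gpdLE

lemma middle_of_projective {K Z P : A} {f : K ⟶ Z} {g : Z ⟶ P} {n : ℕ} (h : IsShortExact f g)
    (hP : Projective P) (hK : gpdLE K n) : gpdLE Z n := by
  cases n with
  | zero => exact IsGorensteinProjective.of_extension h hK (.of_projective hP)
  | succ n =>
    obtain ⟨L, G, k, e, hke, hG, hL⟩ := hK.exists_isShortExact
    have := hke.mono
    have := hke.epi
    have := h.mono
    have := h.epi
    obtain ⟨s, hs⟩ : ∃ s : P ⟶ Z, s ≫ g = 𝟙 P := ⟨_, Projective.factorThru_comp (𝟙 P) g⟩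
    refine of_isShortExact (f := k ≫ biprod.inl) (g := biprod.desc (e ≫ f) s)
      (.of_refinements ?_ inferInstance ?_ fun T t ht ↦ ?_)
      (.of_extension (.biprod_inl_snd G P) hG (.of_projective hP)) hL
    · simp [reassoc_of% hke.zero]
    · rw [Preadditive.epi_iff_cancel_zero]
      intro T t ht
      have h₁ : f ≫ t = 0 := by
        rw [← cancel_epi e]
        simpa using biprod.inl ≫= ht
      have h₂ : s ≫ t = 0 := by simpa using biprod.inr ≫= ht
      obtain ⟨t', rfl⟩ := h.exists_desc t h₁
      rw [reassoc_of% hs] at h₂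
      rw [h₂, comp_zero]
    · have h₁ : t ≫ biprod.snd = 0 := by
        simpa [biprod.desc_eq, h.zero, hs] using ht =≫ g
      have h₂ : (t ≫ biprod.fst) ≫ e = 0 := by
        rw [← cancel_mono f]
        simpa [biprod.desc_eq, reassoc_of% h₁] using ht
      obtain ⟨l, hl⟩ := hke.exists_lift _ h₂
      exact ⟨T, 𝟙 T, inferInstance, l, by ext <;> simp [h₁, hl]⟩

lemma left_of_isGorensteinProjective {K Z G : A} {f : K ⟶ Z} {g : Z ⟶ G} {n : ℕ}
    (h : IsShortExact f g) (hG : IsGorensteinProjective G) (hZ : gpdLE Z n) : gpdLE K n := by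
  cases n with
  | zero => exact IsGorensteinProjective.of_isShortExact h hZ hG
  | succ n =>
    obtain ⟨L, G₀, k, e, hke, hG₀, hL⟩ := hZ.exists_isShortExact
    have := hke.epi
    have := h.epi
    have hW := IsShortExact.of_kernel (e ≫ g)
    obtain ⟨_, _, -, -, h'⟩ := IsShortExact.exists_first_row hke (.zero_id G) (.id_zero L) hW h
      (by simp [reassoc_of% hke.zero]) (by simp)
    exact of_isShortExact h' (.of_isShortExact hW hG₀ hG) hL

/-- A version of Schanuel's lemma. -/
lemma of_projective_presentation {K G K' P M : A} {f : K ⟶ G} {g : G ⟶ M} {f' : K' ⟶ P}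
    {g' : P ⟶ M} {n : ℕ} (h : IsShortExact f g) (h' : IsShortExact f' g')
    (hG : IsGorensteinProjective G) (hP : Projective P) (hK : gpdLE K n) : gpdLE K' n := by
  have := h.epi
  have : Epi (biprod.desc g g') := epi_of_epi_fac (biprod.inl_desc g g')
  have hZ := IsShortExact.of_kernel (biprod.desc g g')
  obtain ⟨_, _, -, -, h₁⟩ := IsShortExact.exists_first_row (.biprod_inl_snd G P) (.id_zero M) h hZ
    (.id_zero P) (by simp) (by simp)
  obtain ⟨_, _, -, -, h₂⟩ := IsShortExact.exists_first_row (.biprod_inr_fst G P) (.id_zero M) h' hZ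
    (.id_zero G) (by simp) (by simp)
  exact left_of_isGorensteinProjective h₂ hG (middle_of_projective h₁ hP hK)

end gpdLE

end GorensteinProjective

section Frobenius

variable {A : Type u} [Category.{v} A] [Abelian A] {B : Type u'} [Category.{v'} B] [Abelian B]
  {F : A ⥤ B} {G : B ⥤ A} [F.Additive] [PreservesFiniteLimits F] [PreservesFiniteColimits F]

lemma IsProperSyzygy.map (adj : F ⊣ G) (hF : ∀ P, Projective P → Projective (F.obj P))
    (hG : ∀ Q, Projective Q → Projective (G.obj Q)) {X Y : A} (h : IsProperSyzygy X Y) :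
    IsProperSyzygy (F.obj X) (F.obj Y) := by
  obtain ⟨P, i, p, hip, hP, hext⟩ := h
  refine ⟨F.obj P, F.map i, F.map p, hip.map F, hF P hP, fun Q hQ f ↦ ?_⟩
  obtain ⟨g, hg⟩ := hext (G.obj Q) (hG Q hQ) (adj.homEquiv _ _ f)
  exact ⟨(adj.homEquiv _ _).symm g, by
    rw [← adj.homEquiv_naturality_left_symm, hg, Equiv.symm_apply_apply]⟩

lemma IsGorensteinProjective.map (adj : F ⊣ G) (hF : ∀ P, Projective P → Projective (F.obj P))
    (hG : ∀ Q, Projective Q → Projective (G.obj Q)) {X : A} (hX : IsGorensteinProjective X) :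
    IsGorensteinProjective (F.obj X) := by
  obtain ⟨Z, ⟨e⟩, hZ⟩ := hX.exists_isProperSyzygy
  exact isGorensteinProjective_of_isProperSyzygy (fun n ↦ F.obj (Z n)) (F.mapIso e)
    fun n ↦ (hZ n).map adj hF hG

lemma gpdLE.map (adj : F ⊣ G) (hF : ∀ P, Projective P → Projective (F.obj P))
    (hG : ∀ Q, Projective Q → Projective (G.obj Q)) {X : A} {n : ℕ} (hX : gpdLE X n) :
    gpdLE (F.obj X) n := by
  induction n generalizing X with
  | zero => exact IsGorensteinProjective.map adj hF hG hX
  | succ n ih =>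
    obtain ⟨K, G₀, f, g, h, hG₀, hK⟩ := hX.exists_isShortExact
    exact .of_isShortExact (h.map F) (hG₀.map adj hF hG) (ih hK)

variable [F.Faithful] [EnoughProjectives A] [EnoughProjectives B]
  [PreservesFiniteLimits G]

lemma IsGorensteinProjective.of_map (adj₁ : F ⊣ G) (adj₂ : G ⊣ F)
    (hF : ∀ P, Projective P → Projective (F.obj P))
    (hG : ∀ Q, Projective Q → Projective (G.obj Q)) {X : A}
    (hX : IsGorensteinProjective (F.obj X)) : IsGorensteinProjective X := by
  have := HasExt.standard A
  refine isGorensteinProjective_of_coresolution.{max u v}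
    (fun X ↦ IsGorensteinProjective (F.obj X)) (fun X hX ↦
      ⟨.of_syzygies (fun X ↦ IsGorensteinProjective (F.obj X)) (fun X hX ↦ ?_) hX, ?_⟩) hX
  · have h := IsShortExact.of_kernel (Projective.π X)
    refine ⟨_, ⟨_, _, _, h, inferInstance, fun Q hQ f ↦ ?_⟩,
      .of_isShortExact_projective (h.map F) (hF _ inferInstance) hX⟩
    let ε : G.obj (F.obj Q) ⟶ Q := adj₂.counit.app Q
    have : Epi ε := inferInstanceAs (Epi (adj₂.counit.app Q))
    obtain ⟨s, hs⟩ : ∃ s : Q ⟶ G.obj (F.obj Q), s ≫ ε = 𝟙 Q :=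
      ⟨_, Projective.factorThru_comp (𝟙 Q) ε⟩
    obtain ⟨l, hl⟩ := hX.exists_extension (h.map F) (hF Q hQ) ((adj₁.homEquiv _ _).symm (f ≫ s))
    refine ⟨adj₁.homEquiv _ _ l ≫ ε, ?_⟩
    rw [← Category.assoc, ← adj₁.homEquiv_naturality_left, hl, Equiv.apply_symm_apply,
      Category.assoc, hs, Category.comp_id]
  · obtain ⟨L, ⟨Q, j, q, hjq, hQ, hext⟩, -⟩ := hX.exists_cosyzygy
    have := hjq.mono
    have : Mono (adj₁.homEquiv _ _ j) := by
      rw [adj₁.homEquiv_unit]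
      infer_instance
    have h := IsShortExact.of_cokernel (adj₁.homEquiv _ _ j)
    refine ⟨_, _, _, _, h, hG Q hQ, hX.of_isProperSyzygy
      ⟨_, _, _, h.map F, hF _ (hG Q hQ), fun Q' hQ' f ↦ ?_⟩⟩
    obtain ⟨g, hg⟩ := hext Q' hQ' f
    have hj : F.map (adj₁.homEquiv _ _ j) ≫ adj₁.counit.app Q = j :=
      (adj₁.homEquiv_counit _ _ _).symm.trans (Equiv.symm_apply_apply _ _)
    exact ⟨adj₁.counit.app Q ≫ g, by rw [← Category.assoc, hj, hg]⟩

lemma gpdLE.of_map (adj₁ : F ⊣ G) (adj₂ : G ⊣ F)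
    (hF : ∀ P, Projective P → Projective (F.obj P))
    (hG : ∀ Q, Projective Q → Projective (G.obj Q)) {X : A} {n : ℕ}
    (hX : gpdLE (F.obj X) n) : gpdLE X n := by
  induction n generalizing X with
  | zero => exact IsGorensteinProjective.of_map adj₁ adj₂ hF hG hX
  | succ n ih =>
    obtain ⟨K, G₀, f, g, h, hG₀, hK⟩ := hX.exists_isShortExact
    have hπ := IsShortExact.of_kernel (Projective.π X)
    exact .of_isShortExact hπ (.of_projective inferInstance)
      (ih (.of_projective_presentation h (hπ.map F) hG₀ (hF _ inferInstance) hK))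

end Frobenius

/-- If `(F, G)` is a Frobenius pair between abelian categories with enough projectives
and `F` is faithful, then `Gpd(X) = Gpd(F X)` for every object `X` of `C`. -/
theorem frobenius_pair_gpd_eq {C D : Type*} [Category C] [Category D]
    [Abelian C] [Abelian D] [EnoughProjectives C] [EnoughProjectives D]
    (F : C ⥤ D) (G : D ⥤ C) [F.Additive] [G.Additive]
    (adj₁ : F ⊣ G) (adj₂ : G ⊣ F) [F.Faithful] (X : C) :
    ∀ n : ℕ, gpdLE X n ↔ gpdLE (F.obj X) n := by
  have : F.IsLeftAdjoint := adj₁.isLeftAdjoint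
  have : F.IsRightAdjoint := adj₂.isRightAdjoint
  have : G.IsLeftAdjoint := adj₂.isLeftAdjoint
  have : G.IsRightAdjoint := adj₁.isRightAdjoint
  have hF (P : C) (hP : Projective P) : Projective (F.obj P) := adj₁.map_projective P hP
  have hG (Q : D) (hQ : Projective Q) : Projective (G.obj Q) := adj₂.map_projective Q hQ
  exact fun n ↦ ⟨fun h ↦ h.map adj₁ hF hG, fun h ↦ .of_map adj₁ adj₂ hF hG h⟩
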